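/- Let S be a finite set of prime numbers each congruent to 1 mod 4, let Σ = {2} ∪ {primes p ≡ 3 mod 4} ∪ S, and let u ∈ {1, 5}. Define f(n) = 2^{ω(n)} if n is squarefree and no prime factor of n lies in Σ, and f(n) = 0 otherwise, and let C = lim_{T→∞} ∏_{primes p ≤ T} (1 + f(p)/p)(1 − 1/p). Then ∑_{1 ≤ n ≤ Y, n ≡ u (mod 8)} f(n) = (1/2)·C·Y + o(Y) as Y → ∞. -/

import Mathlib

open Filter Asymptotics
noncomputable section
/-- For `S` a finite set of primes, `fSigma S n = 2^{ω(n)}` if `n` is squarefree and no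
prime factor of `n` lies in `Σ = {2} ∪ {primes ≡ 3 mod 4} ∪ S`, and `0` otherwise. -/
def fSigma (S : Finset ℕ) (n : ℕ) : ℝ := by
  classical
  exact if Squarefree n ∧
      ∀ p : ℕ, p.Prime → p ∣ n → ¬(p = 2 ∨ (p.Prime ∧ p % 4 = 3) ∨ p ∈ S) then
    2 ^ n.primeFactors.card
  else 0
open ArithmeticFunction Finset in
theorem hyp_bound (a b : ArithmeticFunction ℝ) (ha : ∀ n, |a n| ≤ 1) (hb : ∀ n, |b n| ≤ 1)
    (K c α : ℝ) (hK : ∀ n, |∑ i ∈ Ioc 0 n, b i| ≤ K) (hc : ∀ n : ℕ, |∑ i ∈ Ioc 0 n, a i - α * n| ≤ c)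
    (N : ℕ) : |∑ n ∈ Ioc 0 N, (b * a) n - α * N * ∑ n ∈ Ioc 0 (Nat.sqrt N), b n / n|
      ≤ (2 * K + c + |α|) * Nat.sqrt N := by
  set z := Nat.sqrt N with hz
  have hK0 : 0 ≤ K := (abs_nonneg _).trans (hK 0)
  let b1 : ArithmeticFunction ℝ := ⟨fun n => if n ≤ z then b n else 0, by simp⟩
  let b2 : ArithmeticFunction ℝ := ⟨fun n => if n ≤ z then 0 else b n, by simp⟩
  have hb1 : ∀ n, b1 n = if n ≤ z then b n else 0 := fun n => rfl
  have hb2 : ∀ n, b2 n = if n ≤ z then 0 else b n := fun n => rfl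
  have hsplit : b = b1 + b2 := by
    ext n
    rw [ArithmeticFunction.add_apply, hb1, hb2]
    split_ifs <;> simp
  have hzN : z ≤ N := Nat.sqrt_le_self N
  have h1 : ∑ n ∈ Ioc 0 N, (b1 * a) n = ∑ n ∈ Ioc 0 z, b n * ∑ m ∈ Ioc 0 (N / n), a m := by
    rw [sum_Ioc_mul_eq_sum_sum]
    symm
    rw [← Finset.sum_subset (Finset.Ioc_subset_Ioc_right hzN)]
    · refine Finset.sum_congr rfl fun n hn => ?_
      rw [hb1, if_pos (Finset.mem_Ioc.1 hn).2]
    · intro n hn hn'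
      have : ¬ n ≤ z := by
        simp only [mem_Ioc] at hn hn'; omega
      rw [hb1, if_neg this, zero_mul]
  have hin : ∀ k, |∑ m ∈ Ioc 0 k, b2 m| ≤ 2 * K := by
    intro k
    have : ∑ m ∈ Ioc 0 k, b2 m = ∑ m ∈ Ioc 0 k, b m - ∑ m ∈ Ioc 0 (min k z), b m := by
      rw [eq_sub_iff_add_eq]
      have : ∑ m ∈ Ioc 0 (min k z), b m = ∑ m ∈ Ioc 0 k, b1 m := by
        rw [← Finset.sum_subset (Finset.Ioc_subset_Ioc_right (min_le_left k z))]
        · refine Finset.sum_congr rfl fun n hn => ?_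
          rw [hb1, if_pos ((Finset.mem_Ioc.1 hn).2.trans (min_le_right _ _))]
        · intro n hn hn'
          have : ¬ n ≤ z := by
            simp only [mem_Ioc] at hn hn'; omega
          rw [hb1, if_neg this]
      rw [this, ← Finset.sum_add_distrib]
      refine Finset.sum_congr rfl fun n hn => ?_
      rw [hb1, hb2]
      split_ifs <;> simp
    rw [this]
    have e1 := abs_le.1 (hK k)
    have e2 := abs_le.1 (hK (min k z))
    exact abs_le.2 ⟨by linarith [e1.1, e2.2], by linarith [e1.2, e2.1]⟩
  have hin0 : ∀ k, k ≤ z → ∑ m ∈ Ioc 0 k, b2 m = 0 := by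
    intro k hk
    refine Finset.sum_eq_zero fun n hn => ?_
    rw [hb2, if_pos ((Finset.mem_Ioc.1 hn).2.trans hk)]
  have h2 : |∑ n ∈ Ioc 0 N, (a * b2) n| ≤ 2 * K * z := by
    rw [sum_Ioc_mul_eq_sum_sum]
    have : ∑ n ∈ Ioc 0 N, a n * ∑ m ∈ Ioc 0 (N / n), b2 m
        = ∑ n ∈ Ioc 0 z, a n * ∑ m ∈ Ioc 0 (N / n), b2 m := by
      symm
      refine Finset.sum_subset (Finset.Ioc_subset_Ioc_right hzN) ?_
      intro n hn hn'
      have : z < n := by simp only [mem_Ioc] at hn hn'; omega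
      rw [hin0, mul_zero]
      have h3 : N / n < z + 1 := by
        rw [Nat.div_lt_iff_lt_mul (by omega)]
        have := Nat.lt_succ_sqrt N
        rw [← hz] at this
        calc N < (z+1) * (z+1) := this
          _ ≤ _ := by gcongr; omega
      omega
    rw [this]
    calc _ ≤ ∑ n ∈ Ioc 0 z, |a n * ∑ m ∈ Ioc 0 (N / n), b2 m| := Finset.abs_sum_le_sum_abs _ _
      _ ≤ ∑ n ∈ Ioc 0 z, 2 * K := by
        refine Finset.sum_le_sum fun n _ => ?_
        rw [abs_mul]
        calc _ ≤ 1 * (2 * K) := mul_le_mul (ha n) (hin _) (abs_nonneg _) zero_le_one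
          _ = _ := one_mul _
      _ = _ := by simp; ring
  have h3 : |∑ n ∈ Ioc 0 N, (b1 * a) n - α * N * ∑ n ∈ Ioc 0 z, b n / n| ≤ (c + |α|) * z := by
    rw [h1, Finset.mul_sum, ← Finset.sum_sub_distrib]
    calc _ ≤ ∑ n ∈ Ioc 0 z, _ := Finset.abs_sum_le_sum_abs _ _
      _ ≤ ∑ n ∈ Ioc 0 z, (c + |α|) := by
        refine Finset.sum_le_sum fun n hn => ?_
        have hn0 : 0 < n := (Finset.mem_Ioc.1 hn).1
        have hn0' : (0:ℝ) < n := by exact_mod_cast hn0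
        have e : b n * ∑ m ∈ Ioc 0 (N / n), a m - α * N * (b n / n) =
          b n * ((∑ m ∈ Ioc 0 (N / n), a m - α * (N / n : ℕ)) + α * ((N / n : ℕ) - (N:ℝ) / n)) := by
          field_simp; ring
        rw [e, abs_mul]
        have h4 : |((N / n : ℕ) : ℝ) - (N:ℝ) / n| ≤ 1 := by
          rw [← Nat.floor_div_eq_div (K := ℝ), abs_le]
          have := Nat.floor_le (show (0:ℝ) ≤ (N:ℝ) / n by positivity)
          have := Nat.lt_floor_add_one ((N:ℝ) / n)
          constructor <;> linarith
        calc _ ≤ 1 * (c + |α|) := by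
              refine mul_le_mul (hb n) ?_ (abs_nonneg _) zero_le_one
              refine (abs_add_le _ _).trans (add_le_add (hc _) ?_)
              rw [abs_mul]
              exact mul_le_of_le_one_right (abs_nonneg _) h4
          _ = _ := one_mul _
      _ = _ := by simp; ring
  have h4 : ∑ n ∈ Ioc 0 N, (b * a) n = ∑ n ∈ Ioc 0 N, (b1 * a) n + ∑ n ∈ Ioc 0 N, (a * b2) n := by
    rw [mul_comm a b2, ← Finset.sum_add_distrib]
    conv_lhs => rw [hsplit, add_mul]
    rfl
  rw [h4]
  have := abs_add_le (∑ n ∈ Ioc 0 N, (b1 * a) n - α * N * ∑ n ∈ Ioc 0 z, b n / n) (∑ n ∈ Ioc 0 N, (a * b2) n)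
  rw [show ∑ n ∈ Ioc 0 N, (b1 * a) n + ∑ n ∈ Ioc 0 N, (a * b2) n - α * N * ∑ n ∈ Ioc 0 z, b n / n = (∑ n ∈ Ioc 0 N, (b1 * a) n - α * N * ∑ n ∈ Ioc 0 z, b n / n) + (∑ n ∈ Ioc 0 N, (a * b2) n) by ring]
  linarith

open Finset in
theorem periodic_bound (q : ℕ) (hq : 0 < q) (b : ℕ → ℝ) (hb : ∀ n, |b n| ≤ 1) (hper : ∀ n, b (n + q) = b n)
    (h0 : ∑ i ∈ range q, b i = 0) (n : ℕ) : |∑ i ∈ range n, b i| ≤ q := by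
  induction n using Nat.strong_induction_on with
  | _ n ih =>
    by_cases hn : n < q
    · calc _ ≤ ∑ i ∈ range n, |b i| := abs_sum_le_sum_abs _ _
        _ ≤ ∑ i ∈ range n, (1:ℝ) := sum_le_sum fun i _ => hb i
        _ = n := by simp
        _ ≤ q := by exact_mod_cast hn.le
    · obtain ⟨m, rfl⟩ := Nat.exists_eq_add_of_le (not_lt.1 hn)
      rw [sum_range_add, h0, zero_add]
      simp_rw [show ∀ x, b (q + x) = b x from fun x => by rw [add_comm, hper]]
      exact ih m (by omega)

open Finset in
theorem sum_Ioc_eq_range (b : ℕ → ℝ) (h0 : b 0 = 0) (n : ℕ) : ∑ i ∈ Ioc 0 n, b i = ∑ i ∈ range (n+1), b i := by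
  induction n with
  | zero => simp [h0]
  | succ n ih => rw [Finset.sum_range_succ, ← ih, Finset.sum_Ioc_succ_top (by omega)]

/-- mean value of `b * a` -/
theorem mean_conv (a b : ArithmeticFunction ℝ) (ha : ∀ n, |a n| ≤ 1) (hb : ∀ n, |b n| ≤ 1)
    (K c α : ℝ) (hK : ∀ n, |∑ i ∈ Finset.Ioc 0 n, b i| ≤ K)
    (hc : ∀ n : ℕ, |∑ i ∈ Finset.Ioc 0 n, a i - α * n| ≤ c) :
    ∃ β, Tendsto (fun N : ℕ => (∑ n ∈ Finset.Ioc 0 N, (b * a) n) / N) atTop (nhds (α * β)) := by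
  have hcau : CauchySeq fun n ↦ ∑ i ∈ Finset.range n, (1 / ((i:ℝ) + 1)) • b (i+1) := by
    refine Antitone.cauchySeq_series_mul_of_tendsto_zero_of_bounded (b := K) ?_ ?_ ?_
    · intro i j hij
      have : (i:ℝ) ≤ j := by exact_mod_cast hij
      dsimp only
      gcongr
    · exact tendsto_one_div_add_atTop_nhds_zero_nat
    · intro n
      have := hK n
      rw [sum_Ioc_eq_range _ (by simp), Finset.sum_range_succ'] at this
      simpa using this
  obtain ⟨β, hβ⟩ := cauchySeq_tendsto_of_complete hcau
  refine ⟨β, ?_⟩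
  have hsq : Tendsto Nat.sqrt atTop atTop := by
    refine tendsto_atTop_atTop.2 fun k => ⟨k*k, fun n hn => ?_⟩
    exact Nat.le_sqrt.2 hn
  have hβ' := (hβ.comp hsq).const_mul α
  have hdiff : Tendsto (fun N : ℕ => (∑ n ∈ Finset.Ioc 0 N, (b * a) n) / N -
     α * ∑ i ∈ Finset.range (Nat.sqrt N), (1 / ((i:ℝ) + 1)) • b (i+1)) atTop (nhds 0) := by
    have hz : Tendsto (fun N : ℕ => (2 * K + c + |α|) * (1 / (Nat.sqrt N : ℝ))) atTop (nhds 0) := by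
      have := (tendsto_one_div_atTop_nhds_zero_nat (𝕜 := ℝ)).comp hsq
      simpa using this.const_mul (2 * K + c + |α|)
    refine squeeze_zero_norm' ?_ hz
    filter_upwards [eventually_ge_atTop 1] with N hN
    have hN' : (0:ℝ) < N := by exact_mod_cast hN
    have hs : 0 < Nat.sqrt N := Nat.sqrt_pos.2 hN
    have hs' : (0:ℝ) < Nat.sqrt N := by exact_mod_cast hs
    have hb := hyp_bound a b ha hb K c α hK hc N
    have e : ∑ n ∈ Finset.Ioc 0 (Nat.sqrt N), b n / n = ∑ i ∈ Finset.range (Nat.sqrt N), (1 / ((i:ℝ) + 1)) • b (i+1) := by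
      rw [sum_Ioc_eq_range (fun n => b n / n) (by simp), Finset.sum_range_succ']
      simp only [ArithmeticFunction.map_zero, zero_div, add_zero]
      refine Finset.sum_congr rfl fun i _ => ?_
      push_cast
      rw [smul_eq_mul]; ring
    rw [e] at hb
    have e2 : (∑ n ∈ Finset.Ioc 0 N, (b * a) n) / N - α * ∑ i ∈ Finset.range (Nat.sqrt N), (1 / ((i:ℝ) + 1)) • b (i+1)
      = (∑ n ∈ Finset.Ioc 0 N, (b * a) n - α * N * ∑ i ∈ Finset.range (Nat.sqrt N), (1 / ((i:ℝ) + 1)) • b (i+1)) / N := by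
      field_simp
    rw [e2, Real.norm_eq_abs, abs_div, abs_of_pos hN', div_le_iff₀ hN']
    refine hb.trans ?_
    have hpos : 0 ≤ 2 * K + c + |α| := by
      have := (abs_nonneg _).trans (hK 0)
      have := (abs_nonneg _).trans (hc 0)
      positivity
    rw [mul_assoc]
    refine mul_le_mul_of_nonneg_left ?_ hpos
    rw [one_div, inv_mul_eq_div, le_div_iff₀ hs']
    exact_mod_cast Nat.sqrt_le N
  have := hdiff.add hβ'
  simpa using this

open ArithmeticFunction in
/-- Wintner style -/
theorem mean_wintner (g r : ArithmeticFunction ℝ) (hg : Summable fun n : ℕ => |g n| / n) (δ : ℝ)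
    (hr : Tendsto (fun N : ℕ => (∑ n ∈ Finset.Ioc 0 N, r n) / N) atTop (nhds δ)) :
    Tendsto (fun N : ℕ => (∑ n ∈ Finset.Ioc 0 N, (g * r) n) / N) atTop (nhds (∑' d : ℕ, g d / d * δ)) := by
  obtain ⟨K, hK⟩ : ∃ K, ∀ N : ℕ, |(∑ n ∈ Finset.Ioc 0 N, r n) / N| ≤ K := by
    obtain ⟨K, hK⟩ := hr.bddAbove_range
    obtain ⟨K', hK'⟩ := hr.bddBelow_range
    refine ⟨max K (-K'), fun N => abs_le.2 ⟨?_, ?_⟩⟩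
    · have := hK' (Set.mem_range_self N)
      have h2 := le_max_right K (-K')
      linarith
    · have := hK (Set.mem_range_self N)
      exact this.trans (le_max_left _ _)
  have hK0 : 0 ≤ K := (abs_nonneg _).trans (hK 0)
  have key : ∀ N : ℕ, 0 < N → (∑ n ∈ Finset.Ioc 0 N, (g * r) n) / N =
      ∑' d : ℕ, g d * ((∑ n ∈ Finset.Ioc 0 (N / d), r n) / N) := by
    intro N hN
    rw [sum_Ioc_mul_eq_sum_sum, tsum_eq_sum (s := Finset.Ioc 0 N), Finset.sum_div]
    · simp_rw [mul_div_assoc]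
    · intro d hd
      rcases Nat.eq_zero_or_pos d with rfl | h
      · simp
      · have : N < d := by simp only [Finset.mem_Ioc] at hd; omega
        rw [Nat.div_eq_of_lt this]; simp
  refine (tendsto_congr' ?_).2 (tendsto_tsum_of_dominated_convergence (f := fun N : ℕ => fun d : ℕ => g d * ((∑ n ∈ Finset.Ioc 0 (N / d), r n) / N)) (bound := fun d : ℕ => K * (|g d| / d)) (hg.mul_left K) ?_ ?_)
  · filter_upwards [eventually_gt_atTop 0] with N hN using key N hN
  · intro d
    rcases Nat.eq_zero_or_pos d with rfl | hd
    · simp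
    have hd' : (0:ℝ) < d := by exact_mod_cast hd
    have h1 : Tendsto (fun N : ℕ => N / d) atTop atTop := Nat.tendsto_div_const_atTop hd.ne'
    have h2 := hr.comp h1
    have h3 : Tendsto (fun N : ℕ => ((N / d : ℕ) : ℝ) / N) atTop (nhds (1 / d)) := by
      have := (tendsto_nat_floor_mul_div_atTop (R := ℝ) (a := 1 / d) (by positivity)).comp tendsto_natCast_atTop_atTop
      refine this.congr fun N => ?_
      simp only [Function.comp]
      rw [← Nat.floor_div_eq_div (K := ℝ), one_div_mul_eq_div]
    have := (h2.mul h3).const_mul (g d)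
    rw [show g d / d * δ = g d * (δ * (1 / d)) by ring]
    refine this.congr' ?_
    filter_upwards [eventually_ge_atTop d] with N hN
    have : ((N / d : ℕ) : ℝ) ≠ 0 := by
      have := Nat.div_pos hN hd
      positivity
    simp only [Function.comp]
    congr 1
    field_simp
  · filter_upwards [eventually_gt_atTop 0] with N hN d
    rcases Nat.eq_zero_or_pos d with rfl | hd
    · simp
    have hd' : (0:ℝ) < d := by exact_mod_cast hd
    have hN' : (0:ℝ) < N := by exact_mod_cast hN
    rw [Real.norm_eq_abs, abs_mul]
    rw [show K * (|g d| / d) = |g d| * (K / d) by ring]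
    refine mul_le_mul_of_nonneg_left ?_ (abs_nonneg _)
    have h1 := hK (N / d)
    rw [abs_div, Nat.abs_cast] at h1 ⊢
    rw [div_le_div_iff₀ hN' hd']
    rcases Nat.eq_zero_or_pos (N / d) with h | h
    · rw [h]; simp; positivity
    · have h' : (0:ℝ) < (N / d : ℕ) := by exact_mod_cast h
      rw [div_le_iff₀ h'] at h1
      have h2 : ((N / d : ℕ) : ℝ) * d ≤ N := by exact_mod_cast Nat.div_mul_le_self N d
      nlinarith
open ArithmeticFunction Finset in
theorem conv_prime_pow (k h : ArithmeticFunction ℝ) (p : ℕ) (hp : p.Prime) (k1 : k 1 = 1)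
    (k2 : ∀ j, 2 ≤ j → k (p ^ j) = 0) (e : ℕ) :
    (k * h) (p ^ (e + 1)) = h (p ^ (e + 1)) + k p * h (p ^ e) := by
  rw [ArithmeticFunction.mul_apply, Nat.sum_divisorsAntidiagonal (fun x y => k x * h y),
    Nat.sum_divisors_prime_pow hp, Finset.sum_range_succ', Finset.sum_range_succ']
  have : ∑ i ∈ range e, k (p ^ (i + 1 + 1)) * h (p ^ (e + 1) / p ^ (i + 1 + 1)) = 0 :=
    Finset.sum_eq_zero fun i _ => by rw [k2 _ (by omega), zero_mul]
  rw [this]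
  have e1 : p ^ (e + 1) / p = p ^ e := by
    rw [pow_succ, Nat.mul_div_cancel _ hp.pos]
  simp [k1, e1]
  ring

open ArithmeticFunction Finset in
theorem summable_of_local (g : ArithmeticFunction ℝ) (hg : g.IsMultiplicative) (P : Finset ℕ)
    (h1 : ∀ p, p.Prime → |g p| ≤ 4) (h1' : ∀ p, p.Prime → p ∉ P → g p = 0)
    (h2 : ∀ p, p.Prime → |g (p ^ 2)| ≤ 5) (h3 : ∀ p, p.Prime → |g (p ^ 3)| ≤ 2)
    (h4 : ∀ p, p.Prime → ∀ e, 4 ≤ e → g (p ^ e) = 0) :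
    Summable fun n : ℕ => |g n| / n := by
  set F : ℕ → ℝ := fun n => |g n| / n with hF
  have hF0 : ∀ n, 0 ≤ F n := fun n => by positivity
  have F1 : F 1 = 1 := by simp [hF, hg.map_one]
  have Fmul : ∀ {m n : ℕ}, Nat.Coprime m n → F (m * n) = F m * F n := by
    intro m n hmn
    simp only [hF]
    rw [hg.map_mul_of_coprime hmn, abs_mul]
    push_cast
    rw [div_mul_div_comm]
  have Ffin : ∀ p : ℕ, p.Prime → ∀ e ∉ range 4, F (p ^ e) = 0 := by
    intro p hp e he
    simp only [hF]
    rw [h4 p hp e (by simpa using he)]; simp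
  have Fsum : ∀ {p : ℕ}, p.Prime → Summable (fun n : ℕ => ‖F (p ^ n)‖) := by
    intro p hp
    refine summable_of_ne_finset_zero (s := range 4) fun e he => ?_
    rw [Ffin p hp e he]; simp
  set t : ℕ → ℝ := fun p => (if p ∈ P then 4 else 0) + 7 * (1 / (p:ℝ) ^ 2) with ht
  have tsm : Summable t := by
    refine Summable.add ?_ ?_
    · exact summable_of_ne_finset_zero (s := P) fun b hb => by simp [hb]
    · exact (Real.summable_one_div_nat_pow.2 (by norm_num)).mul_left 7
  have t0 : ∀ p, 0 ≤ t p := fun p => by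
    simp only [ht]; split_ifs <;> positivity
  have loc : ∀ p, p.Prime → ∑' e, F (p ^ e) ≤ Real.exp (t p) := by
    intro p hp
    rw [tsum_eq_sum (s := range 4) (Ffin p hp)]
    have hp1 : (1:ℝ) ≤ p := by exact_mod_cast hp.one_lt.le
    have hp0 : (0:ℝ) < p := by linarith
    simp only [Finset.sum_range_succ, Finset.sum_range_zero, pow_zero, pow_one, F1, zero_add]
    have b1 : F p ≤ if p ∈ P then 4 else 0 := by
      simp only [hF]
      split_ifs with h
      · exact (div_le_self (abs_nonneg _) hp1).trans (h1 p hp)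
      · rw [h1' p hp h]; simp
    have b2 : F (p ^ 2) ≤ 5 * (1 / (p:ℝ) ^ 2) := by
      simp only [hF]
      push_cast
      rw [mul_one_div]
      gcongr
      exact h2 p hp
    have b3 : F (p ^ 3) ≤ 2 * (1 / (p:ℝ) ^ 2) := by
      simp only [hF]
      push_cast
      rw [mul_one_div]
      gcongr
      · exact h3 p hp
      · norm_num
    have := Real.add_one_le_exp (t p)
    simp only [ht] at this ⊢
    linarith
  refine summable_of_sum_range_le (c := Real.exp (∑' p, t p)) hF0 fun N => ?_
  obtain ⟨hs, hh⟩ := EulerProduct.summable_and_hasSum_smoothNumbers_prod_primesBelow_tsum F1 Fmul Fsum N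
  have hind : HasSum (Set.indicator (N.smoothNumbers) F) (∏ p ∈ N.primesBelow, ∑' n : ℕ, F (p ^ n)) :=
    (hasSum_subtype_iff_indicator).1 hh
  calc ∑ i ∈ range N, F i = ∑ i ∈ range N, Set.indicator (N.smoothNumbers) F i := by
        refine Finset.sum_congr rfl fun i hi => ?_
        rcases Nat.eq_zero_or_pos i with rfl | h
        · rw [Set.indicator_of_notMem]
          · simp [hF]
          · intro h; exact Nat.ne_zero_of_mem_smoothNumbers h rfl
        · rw [Set.indicator_of_mem]
          exact Nat.mem_smoothNumbers_of_lt h (Finset.mem_range.1 hi)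
    _ ≤ ∏ p ∈ N.primesBelow, ∑' n : ℕ, F (p ^ n) :=
        sum_le_hasSum _ (fun i _ => Set.indicator_nonneg (fun i _ => hF0 i) i) hind
    _ ≤ ∏ p ∈ N.primesBelow, Real.exp (t p) := by
        refine Finset.prod_le_prod (fun p _ => tsum_nonneg fun e => hF0 _) fun p hp => ?_
        exact loc p (Nat.prime_of_mem_primesBelow hp)
    _ = Real.exp (∑ p ∈ N.primesBelow, t p) := (Real.exp_sum _ _).symm
    _ ≤ _ := Real.exp_le_exp.2 (tsm.sum_le_tsum _ fun p _ => t0 p)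

/-- arithmetic function of a completely multiplicative function -/
def cmAF (θ : ℕ →*₀ ℝ) : ArithmeticFunction ℝ := ⟨θ, map_zero θ⟩

/-- Moebius twisted -/
def muAF (θ : ℕ →*₀ ℝ) : ArithmeticFunction ℝ :=
  ArithmeticFunction.pmul ((ArithmeticFunction.moebius : ArithmeticFunction ℤ) : ArithmeticFunction ℝ) (cmAF θ)

theorem cmAF_apply (θ : ℕ →*₀ ℝ) (n : ℕ) : cmAF θ n = θ n := rfl

theorem cmAF_mult (θ : ℕ →*₀ ℝ) : (cmAF θ).IsMultiplicative :=
  ⟨by simp [cmAF_apply], fun {m n} _ => by simp [cmAF_apply]⟩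

theorem muAF_mult (θ : ℕ →*₀ ℝ) : (muAF θ).IsMultiplicative :=
  ArithmeticFunction.isMultiplicative_moebius.intCast.pmul (cmAF_mult θ)

theorem muAF_mul (θ : ℕ →*₀ ℝ) : muAF θ * cmAF θ = 1 := by
  ext n
  have h := congrArg (fun (F : ArithmeticFunction ℝ) => F n) (ArithmeticFunction.coe_moebius_mul_coe_zeta (R := ℝ))
  simp only [ArithmeticFunction.mul_apply] at h ⊢
  have : ∀ x ∈ n.divisorsAntidiagonal, muAF θ x.1 * cmAF θ x.2 =
    θ n * (((ArithmeticFunction.moebius : ArithmeticFunction ℤ) : ArithmeticFunction ℝ) x.1 * (ArithmeticFunction.zeta : ArithmeticFunction ℝ) x.2) := by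
    intro x hx
    obtain ⟨h1, h2⟩ := Nat.mem_divisorsAntidiagonal.1 hx
    have hx2 : x.2 ≠ 0 := by rintro h; rw [h] at h1; simp at h1; exact h2 h1.symm
    rw [← h1, map_mul]
    simp [muAF, cmAF_apply, hx2]
    ring
  rw [Finset.sum_congr rfl this, ← Finset.mul_sum, h, ArithmeticFunction.one_apply]
  split_ifs with h
  · simp [h]
  · simp

theorem muAF_prime (θ : ℕ →*₀ ℝ) (p : ℕ) (hp : p.Prime) : muAF θ p = - θ p := by
  simp [muAF, cmAF_apply, ArithmeticFunction.moebius_apply_prime hp]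

theorem muAF_prime_pow (θ : ℕ →*₀ ℝ) (p : ℕ) (hp : p.Prime) (j : ℕ) (hj : 2 ≤ j) : muAF θ (p ^ j) = 0 := by
  have : ArithmeticFunction.moebius (p ^ j) = 0 := by
    rw [ArithmeticFunction.moebius_apply_prime_pow hp (by omega), if_neg (by omega)]
  simp [muAF, this]

/-- the character mod 4 -/
def chi4 : ℕ →*₀ ℝ where
  toFun n := ((ZMod.χ₄ (n : ZMod 4) : ℤ) : ℝ)
  map_zero' := by simp
  map_one' := by simp
  map_mul' m n := by rw [Nat.cast_mul, map_mul, Int.cast_mul]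

/-- the character mod 8 -/
def chi8 : ℕ →*₀ ℝ where
  toFun n := ((ZMod.χ₈ (n : ZMod 8) : ℤ) : ℝ)
  map_zero' := by simp
  map_one' := by simp
  map_mul' m n := by rw [Nat.cast_mul, map_mul, Int.cast_mul]

theorem chi4_apply (n : ℕ) : chi4 n = if n % 2 = 0 then 0 else if n % 4 = 1 then 1 else -1 := by
  change ((ZMod.χ₄ (n : ZMod 4) : ℤ) : ℝ) = _
  rw [ZMod.χ₄_nat_eq_if_mod_four]
  split_ifs <;> simp

theorem chi8_apply (n : ℕ) : chi8 n = if n % 2 = 0 then 0 else if n % 8 = 1 ∨ n % 8 = 7 then 1 else -1 := by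
  change ((ZMod.χ₈ (n : ZMod 8) : ℤ) : ℝ) = _
  rw [ZMod.χ₈_nat_eq_if_mod_eight]
  split_ifs <;> simp

open Classical in
theorem fSigma_def (S : Finset ℕ) (n : ℕ) : fSigma S n = if Squarefree n ∧
      ∀ p : ℕ, p.Prime → p ∣ n → ¬(p = 2 ∨ (p.Prime ∧ p % 4 = 3) ∨ p ∈ S) then
    2 ^ n.primeFactors.card
  else 0 := by
  unfold fSigma
  split_ifs <;> rfl

theorem fSigma_nonneg (S : Finset ℕ) (n : ℕ) : 0 ≤ fSigma S n := by
  classical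
  rw [fSigma_def]; split_ifs <;> positivity

/-- f as arithmetic function -/
def fA (S : Finset ℕ) : ArithmeticFunction ℝ := ⟨fSigma S, by
  classical
  rw [fSigma_def, if_neg]; rintro ⟨h, -⟩; exact not_squarefree_zero h⟩

theorem fA_apply (S : Finset ℕ) (n : ℕ) : fA S n = fSigma S n := rfl

theorem fA_mult (S : Finset ℕ) : (fA S).IsMultiplicative := by
  classical
  constructor
  · rw [fA_apply, fSigma_def, if_pos]
    · simp
    · refine ⟨squarefree_one, fun p hp h => ?_⟩
      exact absurd (Nat.dvd_one.1 h) hp.ne_one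
  · intro m n hmn
    rw [fA_apply, fA_apply, fA_apply, fSigma_def, fSigma_def, fSigma_def, ite_zero_mul_ite_zero, ← pow_add,
      hmn.primeFactors_mul, Finset.card_union_of_disjoint hmn.disjoint_primeFactors]
    congr 1
    rw [Nat.squarefree_mul hmn, eq_iff_iff]
    constructor
    · rintro ⟨⟨h1, h2⟩, h3⟩
      exact ⟨⟨h1, fun p hp hd => h3 p hp (hd.mul_right _)⟩, ⟨h2, fun p hp hd => h3 p hp (hd.mul_left _)⟩⟩
    · rintro ⟨⟨h1, h2⟩, h3, h4⟩
      exact ⟨⟨h1, h3⟩, fun p hp hd => ((Nat.Prime.dvd_mul hp).1 hd).elim (h2 p hp) (h4 p hp)⟩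

open Classical in
theorem fSigma_prime (S : Finset ℕ) (p : ℕ) (hp : p.Prime) :
    fSigma S p = if p = 2 ∨ p % 4 = 3 ∨ p ∈ S then 0 else 2 := by
  rw [fSigma_def]
  by_cases h : p = 2 ∨ p % 4 = 3 ∨ p ∈ S
  · rw [if_pos h, if_neg]
    rintro ⟨-, h2⟩
    exact h2 p hp dvd_rfl (by tauto)
  · rw [if_neg h, if_pos]
    · rw [hp.primeFactors]; simp
    · refine ⟨hp.squarefree, fun q hq hd => ?_⟩
      rw [(Nat.prime_dvd_prime_iff_eq hq hp).1 hd]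
      tauto

theorem fSigma_prime_pow (S : Finset ℕ) (p : ℕ) (hp : p.Prime) (j : ℕ) (hj : 2 ≤ j) : fSigma S (p ^ j) = 0 := by
  classical
  rw [fSigma_def, if_neg]
  rintro ⟨h, -⟩
  rw [Nat.squarefree_pow_iff hp.ne_one (by omega)] at h
  omega

theorem fSigma_mod (S : Finset ℕ) (n : ℕ) (h : fSigma S n ≠ 0) : n % 4 = 1 := by
  classical
  rw [fSigma_def, ite_ne_right_iff] at h
  obtain ⟨⟨hs, h⟩, -⟩ := h
  have hn0 : n ≠ 0 := hs.ne_zero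
  clear hs
  induction n using Nat.recOnMul with
  | zero => exact absurd rfl hn0
  | one => rfl
  | prime p hp =>
    have := h p hp dvd_rfl
    have := hp.eq_two_or_odd
    have h3 : p % 4 ≠ 3 := by tauto
    omega
  | mul a b ha hb =>
    have ha' := ha (fun p hp hd => h p hp (hd.mul_right _)) (left_ne_zero_of_mul hn0)
    have hbm := hb (fun p hp hd => h p hp (hd.mul_left _)) (right_ne_zero_of_mul hn0)
    rw [Nat.mul_mod, ha', hbm]

/-- the correction factor -/
def gA (S : Finset ℕ) (θ : ℕ →*₀ ℝ) : ArithmeticFunction ℝ :=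
  muAF θ * (muAF (θ * chi4) * ArithmeticFunction.pmul (fA S) (cmAF θ))

theorem gA_mul (S : Finset ℕ) (θ : ℕ →*₀ ℝ) :
    ArithmeticFunction.pmul (fA S) (cmAF θ) = gA S θ * (cmAF (θ * chi4) * cmAF θ) := by
  unfold gA
  calc _ = 1 * (1 * ArithmeticFunction.pmul (fA S) (cmAF θ)) := by simp
    _ = (muAF θ * cmAF θ) * ((muAF (θ * chi4) * cmAF (θ * chi4)) * ArithmeticFunction.pmul (fA S) (cmAF θ)) := by
      rw [muAF_mul θ, muAF_mul (θ * chi4)]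
    _ = _ := by ring

theorem gA_summable (S : Finset ℕ) (θ : ℕ →*₀ ℝ) (hθ : ∀ n, |θ n| ≤ 1) :
    Summable fun n : ℕ => |gA S θ n| / n := by
  classical
  set h := ArithmeticFunction.pmul (fA S) (cmAF θ) with hh
  have hm : h.IsMultiplicative := (fA_mult S).pmul (cmAF_mult θ)
  have hp1 : ∀ p : ℕ, h p = fSigma S p * θ p := fun p => rfl
  have hp2 : ∀ p : ℕ, p.Prime → ∀ j, 2 ≤ j → h (p ^ j) = 0 := by
    intro p hp j hj
    rw [hp1, fSigma_prime_pow S p hp j hj, zero_mul]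
  have hθχ : ∀ p : ℕ, (θ * chi4) p = θ p * chi4 p := fun p => rfl
  have step1 : ∀ p : ℕ, p.Prime → ∀ e, gA S θ (p ^ (e+1)) = (muAF (θ * chi4) * h) (p ^ (e+1)) + (- θ p) * (muAF (θ * chi4) * h) (p ^ e) := by
    intro p hp e
    rw [← muAF_prime θ p hp]
    exact conv_prime_pow _ _ p hp (muAF_mult θ).map_one (muAF_prime_pow θ p hp) e
  have step2 : ∀ p : ℕ, p.Prime → ∀ e, (muAF (θ * chi4) * h) (p ^ (e+1)) = h (p ^ (e+1)) + (- (θ p * chi4 p)) * h (p ^ e) := by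
    intro p hp e
    rw [← hθχ, ← muAF_prime _ p hp]
    exact conv_prime_pow _ _ p hp (muAF_mult _).map_one (muAF_prime_pow _ p hp) e
  have step0 : ∀ p : ℕ, (muAF (θ * chi4) * h) (p ^ 0) = 1 := by
    intro p
    rw [pow_zero, ((muAF_mult _).mul hm).map_one]
  have h0 : ∀ p : ℕ, h (p ^ 0) = 1 := fun p => by rw [pow_zero, hm.map_one]
  have g1 : ∀ p : ℕ, p.Prime → gA S θ p = θ p * (fSigma S p - 1 - chi4 p) := by
    intro p hp
    have := step1 p hp 0
    rw [step2 p hp, step0, h0, zero_add, pow_one, hp1] at this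
    rw [this]; ring
  have g2 : ∀ p : ℕ, p.Prime → gA S θ (p ^ 2) = θ p * θ p * (- fSigma S p * chi4 p - fSigma S p + chi4 p) := by
    intro p hp
    have := step1 p hp 1
    rw [step2 p hp, step2 p hp, h0, hp2 p hp _ le_rfl, zero_add, pow_one, hp1] at this
    rw [this]; ring
  have g3 : ∀ p : ℕ, p.Prime → gA S θ (p ^ 3) = θ p * θ p * θ p * (fSigma S p * chi4 p) := by
    intro p hp
    have := step1 p hp 2
    rw [step2 p hp, step2 p hp, hp2 p hp _ le_rfl, hp2 p hp _ (by norm_num), pow_one, hp1] at this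
    rw [this]; ring
  have g4 : ∀ p : ℕ, p.Prime → ∀ e, 4 ≤ e → gA S θ (p ^ e) = 0 := by
    intro p hp e he
    obtain ⟨k, rfl⟩ := Nat.exists_eq_add_of_le he
    rw [show 4 + k = (k + 2 + 1) + 1 by ring, step1 p hp, step2 p hp, step2 p hp, hp2 p hp _ (by omega), hp2 p hp _ (by omega), hp2 p hp _ (by omega)]
    ring
  have fb : ∀ p : ℕ, p.Prime → fSigma S p = 0 ∨ fSigma S p = 2 := by
    intro p hp
    rw [fSigma_prime S p hp]; split_ifs <;> simp
  have cb : ∀ p : ℕ, chi4 p = 0 ∨ chi4 p = 1 ∨ chi4 p = -1 := by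
    intro p; rw [chi4_apply]; split_ifs <;> simp
  have mulb : ∀ x y B : ℝ, |x| ≤ 1 → |y| ≤ B → |x * y| ≤ B := by
    intro x y B hx hy
    rw [abs_mul]
    calc _ ≤ 1 * B := mul_le_mul hx hy (abs_nonneg _) zero_le_one
      _ = B := one_mul B
  have θ2 : ∀ p, |θ p * θ p| ≤ 1 := fun p => mulb _ _ _ (hθ p) (hθ p)
  have θ3 : ∀ p, |θ p * θ p * θ p| ≤ 1 := fun p => mulb _ _ _ (θ2 p) (hθ p)
  refine summable_of_local (gA S θ) ((muAF_mult θ).mul ((muAF_mult _).mul hm)) (insert 2 S) ?_ ?_ ?_ ?_ g4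
  · intro p hp
    rw [g1 p hp]
    refine mulb _ _ _ (hθ p) ?_
    rcases fb p hp with h | h <;> rcases cb p with h' | h' | h' <;> rw [h, h'] <;> norm_num
  · intro p hp hP
    rw [Finset.mem_insert, not_or] at hP
    rw [g1 p hp, fSigma_prime S p hp, chi4_apply]
    have := hp.eq_two_or_odd
    rcases this with h | h
    · exact absurd h hP.1
    have : p % 4 = 1 ∨ p % 4 = 3 := by omega
    rcases this with h' | h' <;> simp [hP, h, h'] <;> norm_num
  · intro p hp
    rw [g2 p hp]
    refine mulb _ _ _ (θ2 p) ?_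
    rcases fb p hp with h | h <;> rcases cb p with h' | h' | h' <;> rw [h, h'] <;> norm_num
  · intro p hp
    rw [g3 p hp]
    refine mulb _ _ _ (θ3 p) ?_
    rcases fb p hp with h | h <;> rcases cb p with h' | h' | h' <;> rw [h, h'] <;> norm_num
theorem mean_theta (S : Finset ℕ) (θ : ℕ →*₀ ℝ) (α : ℝ) (hθ : ∀ n, |θ n| ≤ 1) (hθα : ∀ n, |θ n - α| ≤ 1)
    (hper : ∀ n, θ (n + 8) = θ n) (hsum : ∑ i ∈ Finset.range 8, (θ i - α) = 0)
    (hsum4 : ∑ i ∈ Finset.range 8, θ i * chi4 i = 0) :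
    ∃ κ, Tendsto (fun N : ℕ => (∑ n ∈ Finset.Ioc 0 N, fSigma S n * θ n) / N) atTop (nhds (α * κ)) := by
  have hχ : ∀ n, |chi4 n| ≤ 1 := by
    intro n; rw [chi4_apply]; split_ifs <;> simp
  have hχper : ∀ n, chi4 (n + 8) = chi4 n := by
    intro n
    rw [chi4_apply, chi4_apply, show (n + 8) % 2 = n % 2 by omega, show (n + 8) % 4 = n % 4 by omega]
  have hbv : ∀ n, cmAF (θ * chi4) n = θ n * chi4 n := fun n => rfl
  have hb : ∀ n, |cmAF (θ * chi4) n| ≤ 1 := by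
    intro n
    rw [hbv, abs_mul]
    exact mul_le_one₀ (hθ n) (abs_nonneg _) (hχ n)
  obtain ⟨β, hβ⟩ := mean_conv (cmAF θ) (cmAF (θ * chi4)) hθ hb 8 (8 + |α|) α (by
      intro n
      rw [sum_Ioc_eq_range _ (by simp)]
      exact_mod_cast periodic_bound 8 (by norm_num) (fun n => cmAF (θ * chi4) n) hb
        (fun n => by simp only [hbv, hper, hχper]) hsum4 (n+1)) (by
      intro n
      rw [sum_Ioc_eq_range _ (by simp)]
      have h1 := periodic_bound 8 (by norm_num) (fun n => θ n - α) hθα (fun n => by simp only [hper]) hsum (n+1)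
      rw [Finset.sum_sub_distrib] at h1
      simp only [Finset.sum_const, Finset.card_range, nsmul_eq_mul] at h1
      have e : ∑ i ∈ Finset.range (n+1), cmAF θ i - α * n = (∑ i ∈ Finset.range (n+1), θ i - ((n + 1 : ℕ) : ℝ) * α) + α := by
        push_cast
        simp only [cmAF_apply]
        ring
      rw [e]
      refine (abs_add_le _ _).trans (add_le_add ?_ le_rfl)
      exact_mod_cast h1)
  have := mean_wintner (gA S θ) (cmAF (θ * chi4) * cmAF θ) (gA_summable S θ hθ) _ hβ
  rw [← gA_mul] at this
  refine ⟨β * ∑' d : ℕ, gA S θ d / d, ?_⟩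
  rw [tsum_mul_right] at this
  rw [show α * (β * ∑' d : ℕ, gA S θ d / d) = (∑' d : ℕ, gA S θ d / d) * (α * β) by ring]
  exact this

open Finset in
theorem abel_finite (a w : ℕ → ℝ) (M : ℝ) (n0 : ℕ) (hw : Antitone w) (hw0 : ∀ n, 0 ≤ w n) (hw1 : w 0 = 1)
    (hA : ∀ k, n0 ≤ k → ∑ i ∈ range k, a i ≤ M) (N : ℕ) (hN : n0 ≤ N) :
    ∑ n ∈ range N, a n * w n ≤ M + (∑ n ∈ range n0, |∑ i ∈ range (n+1), a i - M|) * (1 - w n0) := by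
  set D : ℕ → ℝ := fun k => ∑ i ∈ range k, a i - M with hD
  have key : ∀ N, ∑ n ∈ range N, a n * w n = M + D N * w N + ∑ n ∈ range N, D (n+1) * (w n - w (n+1)) := by
    intro N
    induction N with
    | zero => simp [hD, hw1]
    | succ N ih =>
      rw [sum_range_succ, ih, sum_range_succ]
      have : D (N+1) = D N + a N := by simp only [hD]; rw [sum_range_succ]; ring
      rw [this]; ring
  rw [key]
  have h1 : D N * w N ≤ 0 := mul_nonpos_of_nonpos_of_nonneg (by have := hA N hN; simp only [hD]; linarith) (hw0 N)
  have h2 : ∑ n ∈ range N, D (n+1) * (w n - w (n+1)) ≤ ∑ n ∈ range n0, D (n+1) * (w n - w (n+1)) := by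
    obtain ⟨m, rfl⟩ := Nat.exists_eq_add_of_le hN
    rw [sum_range_add]
    have : ∑ x ∈ range m, D (n0 + x + 1) * (w (n0 + x) - w (n0 + x + 1)) ≤ 0 := by
      refine sum_nonpos fun x _ => ?_
      refine mul_nonpos_of_nonpos_of_nonneg ?_ (sub_nonneg.2 (hw (Nat.le_succ _)))
      have := hA (n0 + x + 1) (by omega)
      simp only [hD]; linarith
    linarith
  have h3 : ∑ n ∈ range n0, D (n+1) * (w n - w (n+1)) ≤ (∑ n ∈ range n0, |D (n+1)|) * (1 - w n0) := by
    rw [sum_mul]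
    refine sum_le_sum fun n hn => ?_
    have hn' : n + 1 ≤ n0 := Finset.mem_range.1 hn
    have e1 := hw (Nat.zero_le n)
    have e2 := hw hn'
    have e3 := hw (Nat.le_succ n)
    calc _ ≤ |D (n+1)| * (w n - w (n+1)) := mul_le_mul_of_nonneg_right (le_abs_self _) (by simpa using e3)
      _ ≤ _ := mul_le_mul_of_nonneg_left (by linarith) (abs_nonneg _)
  linarith

theorem abel_limit (a : ℕ → ℝ) (E : ℝ → ℝ)
    (hE : ∀ s, 1 < s → Tendsto (fun N : ℕ => ∑ n ∈ Finset.range N, a n * ((n:ℝ) + 1) ^ (-(s - 1))) atTop (nhds (E s)))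
    (M M2 : ℝ) (hM : M < M2) (hA : ∀ᶠ k in atTop, ∑ i ∈ Finset.range k, a i ≤ M) :
    ∀ᶠ s in nhdsWithin (1:ℝ) (Set.Ioi 1), E s ≤ M2 := by
  obtain ⟨n0, hn0⟩ := eventually_atTop.1 hA
  set K := ∑ n ∈ Finset.range n0, |∑ i ∈ Finset.range (n+1), a i - M|
  have hlim : Tendsto (fun s : ℝ => M + K * (1 - ((n0:ℝ) + 1) ^ (-(s - 1)))) (nhdsWithin (1:ℝ) (Set.Ioi 1)) (nhds M) := by
    have hc : ContinuousAt (fun s : ℝ => M + K * (1 - ((n0:ℝ) + 1) ^ (-(s - 1)))) 1 := by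
      have : (n0:ℝ) + 1 ≠ 0 := by positivity
      refine continuousAt_const.add (continuousAt_const.mul (continuousAt_const.sub ?_))
      exact ContinuousAt.rpow continuousAt_const (by fun_prop) (Or.inl this)
    have := hc.tendsto.mono_left (nhdsWithin_le_nhds (s := Set.Ioi 1))
    simpa using this
  filter_upwards [hlim.eventually (gt_mem_nhds hM), self_mem_nhdsWithin] with s hs hs1
  refine le_trans ?_ hs.le
  have hs1' : (1:ℝ) < s := hs1
  refine le_of_tendsto (hE s hs1) ?_
  filter_upwards [eventually_ge_atTop n0] with N hN
  refine abel_finite a (fun n => ((n:ℝ) + 1) ^ (-(s - 1))) M n0 ?_ ?_ ?_ hn0 N hN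
  · intro i j hij
    have : (i:ℝ) ≤ j := by exact_mod_cast hij
    exact Real.rpow_le_rpow_of_nonpos (by positivity) (by linarith) (by linarith)
  · intro n; positivity
  · simp

theorem log_taylor (y : ℝ) (hy : -(1/2) ≤ y) : |Real.log (1 + y) - y| ≤ 2 * y ^ 2 := by
  have h0 : 0 < 1 + y := by linarith
  have h1 := Real.log_le_sub_one_of_pos h0
  have h2 := Real.one_sub_inv_le_log_of_pos h0
  have h3 : 1 - (1 + y)⁻¹ = y - y ^ 2 * (1 + y)⁻¹ := by field_simp; ring
  have h4 : (1 + y)⁻¹ ≤ 2 := by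
    rw [inv_le_comm₀ h0 (by norm_num)]; linarith
  have h5 : y ^ 2 * (1 + y)⁻¹ ≤ y ^ 2 * 2 := mul_le_mul_of_nonneg_left h4 (sq_nonneg y)
  rw [abs_le]
  constructor <;> nlinarith [sq_nonneg y]

/-- local factor -/
def locF (S : Finset ℕ) (s : ℝ) (p : ℕ) : ℝ := (1 + fSigma S p * (p:ℝ) ^ (-s)) * (1 - (p:ℝ) ^ (-s))

/-- log -/
def locL (S : Finset ℕ) (s : ℝ) (p : ℕ) : ℝ := if p.Prime then Real.log (locF S s p) else 0

/-- linear coefficient -/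
def locC (S : Finset ℕ) (p : ℕ) : ℝ := if p.Prime then fSigma S p - 1 else 0

theorem rpow_bd (p : ℕ) (hp : p.Prime) (s : ℝ) (hs : 1 ≤ s) : 0 < (p:ℝ) ^ (-s) ∧ (p:ℝ) ^ (-s) ≤ 1 / p ∧ (p:ℝ) ^ (-s) ≤ 1 / 2 := by
  have hp2 : (2:ℝ) ≤ p := by exact_mod_cast hp.two_le
  have h1 : (p:ℝ) ^ (-s) ≤ 1 / p := by
    rw [one_div, ← Real.rpow_neg_one]
    exact Real.rpow_le_rpow_of_exponent_le (by linarith) (by linarith)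
  refine ⟨by positivity, h1, h1.trans ?_⟩
  gcongr

theorem locF_pos (S : Finset ℕ) (p : ℕ) (hp : p.Prime) (s : ℝ) (hs : 1 ≤ s) : 0 < locF S s p := by
  obtain ⟨h1, h2, h3⟩ := rpow_bd p hp s hs
  have := fSigma_nonneg S p
  unfold locF
  have h4 : 0 < 1 - (p:ℝ) ^ (-s) := by linarith
  positivity

theorem prod_locF (S : Finset ℕ) (s : ℝ) (hs : 1 ≤ s) (N : ℕ) :
    ∏ p ∈ N.primesBelow, locF S s p = Real.exp (∑ n ∈ Finset.range N, locL S s n) := by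
  rw [Real.exp_sum, Nat.primesBelow, Finset.prod_filter]
  refine Finset.prod_congr rfl fun p _ => ?_
  unfold locL
  split_ifs with h
  · rw [Real.exp_log (locF_pos S p h s hs)]
  · simp

theorem locB_bound (S : Finset ℕ) (s : ℝ) (hs : 1 ≤ s) (n : ℕ) :
    |locL S s n - locC S n * (n:ℝ) ^ (-s)| ≤ 10 * (1 / (n:ℝ) ^ 2) := by
  classical
  unfold locL locC
  split_ifs with hp
  · obtain ⟨h1, h2, h3⟩ := rpow_bd n hp s hs
    unfold locF
    set x := (n:ℝ) ^ (-s)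
    have f0 := fSigma_nonneg S n
    have f2 : fSigma S n ≤ 2 := by rw [fSigma_prime S n hp]; split_ifs <;> norm_num
    have fx : 0 ≤ fSigma S n * x := by positivity
    have fx2 : fSigma S n * x ≤ 2 * x := by gcongr
    rw [Real.log_mul (by linarith) (by linarith)]
    have t1 := abs_le.1 (log_taylor (fSigma S n * x) (by linarith))
    have t2 := abs_le.1 (log_taylor (-x) (by linarith))
    rw [← sub_eq_add_neg] at t2
    have t3 : (fSigma S n * x) ^ 2 ≤ (2 * x) ^ 2 := by gcongr
    have t4 : x ^ 2 ≤ 1 / (n:ℝ) ^ 2 := by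
      calc x ^ 2 ≤ (1 / (n:ℝ)) ^ 2 := by gcongr
        _ = _ := by rw [div_pow, one_pow]
    rw [abs_le]
    constructor <;> nlinarith [t1.1, t1.2, t2.1, t2.2]
  · simp

theorem locB_tendsto (S : Finset ℕ) :
    Tendsto (fun s : ℝ => ∑' n : ℕ, (locL S s n - locC S n * (n:ℝ) ^ (-s))) (nhdsWithin (1:ℝ) (Set.Ioi 1))
      (nhds (∑' n : ℕ, (locL S 1 n - locC S n * (n:ℝ) ^ (-1:ℝ)))) := by
  refine tendsto_tsum_of_dominated_convergence (bound := fun n : ℕ => 10 * (1 / (n:ℝ) ^ 2)) ?_ ?_ ?_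
  · exact (Real.summable_one_div_nat_pow.2 (by norm_num)).mul_left 10
  · intro n
    refine Tendsto.mono_left ?_ (nhdsWithin_le_nhds (s := Set.Ioi 1))
    by_cases hp : n.Prime
    · have hn0 : (n:ℝ) ≠ 0 := by exact_mod_cast hp.ne_zero
      have hc : ContinuousAt (fun s : ℝ => (n:ℝ) ^ (-s)) 1 :=
        ContinuousAt.rpow continuousAt_const (by fun_prop) (Or.inl hn0)
      have hF : ContinuousAt (fun s : ℝ => locF S s n) 1 := by
        unfold locF
        exact (continuousAt_const.add (continuousAt_const.mul hc)).mul (continuousAt_const.sub hc)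
      have : ContinuousAt (fun s : ℝ => locL S s n - locC S n * (n:ℝ) ^ (-s)) 1 := by
        unfold locL
        simp only [if_pos hp]
        exact (hF.log (locF_pos S n hp 1 le_rfl).ne').sub (continuousAt_const.mul hc)
      exact this.tendsto
    · simp [locL, locC, hp]
  · filter_upwards [self_mem_nhdsWithin] with s hs n
    exact locB_bound S s (le_of_lt hs) n
theorem F_summable (S : Finset ℕ) (κ : ℝ)
    (hκ : Tendsto (fun N : ℕ => (∑ n ∈ Finset.Icc 1 N, fSigma S n) / (N:ℝ)) atTop (nhds κ)) (s : ℝ) (hs : 1 < s) :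
    Summable (fun n : ℕ => fSigma S n * (n:ℝ) ^ (-s)) := by
  have h : LSeriesSummable (fun n => (fSigma S n : ℂ)) s := by
    refine LSeriesSummable_of_sum_norm_bigO_and_nonneg ?_ (fSigma_nonneg S) zero_le_one hs
    exact isBigO_atTop_natCast_rpow_of_tendsto_div_rpow (by simpa using hκ)
  refine h.norm.congr fun n => ?_
  rcases Nat.eq_zero_or_pos n with rfl | hn
  · have := (fA S).map_zero
    rw [fA_apply] at this
    simp [this]
  · rw [LSeries.norm_term_eq, if_neg hn.ne', Complex.norm_real, Real.norm_eq_abs, abs_of_nonneg (fSigma_nonneg S n),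
      Complex.ofReal_re, Real.rpow_neg (by positivity), div_eq_mul_inv]

theorem F_residue (S : Finset ℕ) (κ : ℝ)
    (hκ : Tendsto (fun N : ℕ => (∑ n ∈ Finset.Icc 1 N, fSigma S n) / (N:ℝ)) atTop (nhds κ)) :
    Tendsto (fun s : ℝ => (s - 1) * ∑' n : ℕ, fSigma S n * (n:ℝ) ^ (-s)) (nhdsWithin (1:ℝ) (Set.Ioi 1)) (nhds κ) := by
  have h := LSeries_tendsto_sub_mul_nhds_one_of_tendsto_sum_div_and_nonneg (fSigma S) hκ (fSigma_nonneg S)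
  have h2 := (Complex.continuous_re.tendsto _).comp h
  rw [Complex.ofReal_re] at h2
  refine h2.congr fun s => ?_
  have : LSeries (fun n => (fSigma S n : ℂ)) s = ((∑' n : ℕ, fSigma S n * (n:ℝ) ^ (-s) : ℝ) : ℂ) := by
    rw [Complex.ofReal_tsum]
    unfold LSeries
    refine tsum_congr fun n => ?_
    rcases Nat.eq_zero_or_pos n with rfl | hn
    · have := (fA S).map_zero
      rw [fA_apply] at this
      simp [this]
    · rw [LSeries.term_of_ne_zero hn.ne']
      rw [Complex.ofReal_mul, Complex.ofReal_cpow (by positivity)]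
      push_cast
      rw [Complex.cpow_neg, div_eq_mul_inv]
  simp only [Function.comp, this]
  rw [← Complex.ofReal_one, ← Complex.ofReal_sub, ← Complex.ofReal_mul, Complex.ofReal_re]

/-- n^(-s) as a hom -/
def powHom (s : ℝ) (hs : 1 < s) : ℕ →*₀ ℝ where
  toFun n := (n:ℝ) ^ (-s)
  map_zero' := by rw [Nat.cast_zero, Real.zero_rpow (by linarith)]
  map_one' := by simp
  map_mul' m n := by rw [Nat.cast_mul, Real.mul_rpow (by positivity) (by positivity)]

theorem euler_quot (S : Finset ℕ) (s : ℝ) (hs : 1 < s)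
    (hF : Summable (fun n : ℕ => fSigma S n * (n:ℝ) ^ (-s))) :
    Tendsto (fun N : ℕ => ∏ p ∈ N.primesBelow, locF S s p) atTop
      (nhds ((∑' n : ℕ, fSigma S n * (n:ℝ) ^ (-s)) / ∑' n : ℕ, (n:ℝ) ^ (-s))) ∧
    0 < (∑' n : ℕ, fSigma S n * (n:ℝ) ^ (-s)) / ∑' n : ℕ, (n:ℝ) ^ (-s) := by
  have hz : Summable (fun n : ℕ => (n:ℝ) ^ (-s)) := Real.summable_nat_rpow.2 (by linarith)
  have hzpos : 0 < ∑' n : ℕ, (n:ℝ) ^ (-s) :=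
    hz.tsum_pos (fun n => by positivity) 1 (by simp)
  have f1 : fSigma S 1 = 1 := (fA_mult S).map_one
  have hFpos : 0 < ∑' n : ℕ, fSigma S n * (n:ℝ) ^ (-s) :=
    hF.tsum_pos (fun n => mul_nonneg (fSigma_nonneg S n) (by positivity)) 1 (by simp [f1])
  refine ⟨?_, div_pos hFpos hzpos⟩
  have e1 : Tendsto (fun N : ℕ => ∏ p ∈ N.primesBelow, (1 - (p:ℝ) ^ (-s))⁻¹) atTop (nhds (∑' n : ℕ, (n:ℝ) ^ (-s))) :=
    EulerProduct.eulerProduct_completely_multiplicative (f := powHom s hs) (hz.norm)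
  have e2 := EulerProduct.eulerProduct (f := fun n : ℕ => fSigma S n * (n:ℝ) ^ (-s)) (by simp [f1])
    (by
      intro m n hmn
      have := (fA_mult S).map_mul_of_coprime hmn
      simp only [fA_apply] at this
      rw [this, Nat.cast_mul, Real.mul_rpow (by positivity) (by positivity)]; ring) hF.norm
    (by simp [show fSigma S 0 = 0 from (fA S).map_zero])
  have := e2.mul (e1.inv₀ hzpos.ne')
  rw [div_eq_mul_inv]
  refine this.congr fun N => ?_
  rw [← Finset.prod_inv_distrib, ← Finset.prod_mul_distrib]
  refine Finset.prod_congr rfl fun p hp => ?_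
  have hp' := Nat.prime_of_mem_primesBelow hp
  rw [inv_inv, locF, tsum_eq_sum (s := Finset.range 2)]
  · simp [Finset.sum_range_succ, f1]
  · intro e he
    rw [fSigma_prime_pow S p hp' e (by have := Finset.mem_range.not.1 he; omega), zero_mul]

theorem C_eq (S : Finset ℕ) (C κ : ℝ)
    (hC : Tendsto (fun N : ℕ => ∏ p ∈ (N+1).primesBelow, locF S 1 p) atTop (nhds C))
    (hκ : Tendsto (fun N : ℕ => (∑ n ∈ Finset.Icc 1 N, fSigma S n) / (N:ℝ)) atTop (nhds κ)) : κ = C := by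
  set B : ℝ → ℝ := fun s => ∑' n : ℕ, (locL S s n - locC S n * (n:ℝ) ^ (-s)) with hB
  set Q : ℝ → ℝ := fun s => (∑' n : ℕ, fSigma S n * (n:ℝ) ^ (-s)) / ∑' n : ℕ, (n:ℝ) ^ (-s) with hQ
  set E : ℝ → ℝ := fun s => Real.log (Q s) - B s with hE
  set a : ℕ → ℝ := fun n => locC S (n+1) / ((n:ℝ) + 1) with ha
  have hBsum : ∀ s, 1 ≤ s → Tendsto (fun N : ℕ => ∑ n ∈ Finset.range (N+1), (locL S s n - locC S n * (n:ℝ) ^ (-s))) atTop (nhds (B s)) := by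
    intro s hs
    have : Summable fun n : ℕ => (locL S s n - locC S n * (n:ℝ) ^ (-s)) :=
      Summable.of_norm_bounded ((Real.summable_one_div_nat_pow.2 (by norm_num : 1 < 2)).mul_left 10) (fun n => locB_bound S s hs n)
    exact this.hasSum.tendsto_sum_nat.comp (tendsto_add_atTop_nat 1)
  have hQlim : ∀ s, 1 < s → Tendsto (fun N : ℕ => ∏ p ∈ N.primesBelow, locF S s p) atTop (nhds (Q s)) ∧ 0 < Q s :=
    fun s hs => euler_quot S s hs (F_summable S κ hκ s hs)
  have hsplit : ∀ s, ∀ N : ℕ, ∑ n ∈ Finset.range N, a n * ((n:ℝ) + 1) ^ (-(s - 1)) =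
      ∑ n ∈ Finset.range (N+1), locL S s n - ∑ n ∈ Finset.range (N+1), (locL S s n - locC S n * (n:ℝ) ^ (-s)) := by
    intro s N
    rw [← Finset.sum_sub_distrib, Finset.sum_range_succ']
    simp only [sub_sub_cancel]
    rw [show locC S 0 = 0 by simp [locC, Nat.not_prime_zero], zero_mul, add_zero]
    refine Finset.sum_congr rfl fun n _ => ?_
    simp only [ha]
    push_cast
    rw [show -s = -1 + -(s-1) by ring, Real.rpow_add (by positivity), Real.rpow_neg_one]
    ring
  have hElim : ∀ s, 1 < s → Tendsto (fun N : ℕ => ∑ n ∈ Finset.range N, a n * ((n:ℝ) + 1) ^ (-(s - 1))) atTop (nhds (E s)) := by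
    intro s hs
    simp_rw [hsplit]
    refine Tendsto.sub ?_ (hBsum s hs.le)
    obtain ⟨h1, h2⟩ := hQlim s hs
    have := (h1.comp (tendsto_add_atTop_nat 1)).log h2.ne'
    refine this.congr fun N => ?_
    simp only [Function.comp]
    rw [prod_locF S s hs.le, Real.log_exp]
  have hA : Tendsto (fun N : ℕ => Real.exp (∑ n ∈ Finset.range N, a n)) atTop (nhds (C * Real.exp (- B 1))) := by
    have h1 := (Real.continuous_exp.tendsto _).comp (hBsum 1 le_rfl).neg
    refine (hC.mul h1).congr fun N => ?_
    simp only [Function.comp]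
    rw [prod_locF S 1 le_rfl, ← Real.exp_add]
    have := hsplit 1 N
    simp only [sub_self, neg_zero, Real.rpow_zero, mul_one] at this
    rw [this, sub_eq_add_neg]
  have hEexp : Tendsto (fun s => Real.exp (E s)) (nhdsWithin (1:ℝ) (Set.Ioi 1)) (nhds (κ * Real.exp (- B 1))) := by
    have hres := F_residue S κ hκ
    have hzeta := tendsto_sub_mul_tsum_nat_rpow
    have h1 := (Real.continuous_exp.tendsto _).comp (locB_tendsto S).neg
    have h2 := (hres.div hzeta one_ne_zero).mul h1
    rw [div_one] at h2
    refine h2.congr' ?_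
    filter_upwards [self_mem_nhdsWithin] with s hs
    have hs' : 1 < s := hs
    simp only [Function.comp, Pi.div_apply]
    rw [hE]
    simp only
    rw [show Real.log (Q s) - B s = Real.log (Q s) + -(B s) from sub_eq_add_neg _ _, Real.exp_add,
      Real.exp_log (hQlim s hs').2]
    congr 1
    simp only [hQ]
    rw [mul_div_mul_left _ _ (sub_ne_zero.2 hs'.ne')]
    simp [Real.rpow_neg]
  set C' := C * Real.exp (- B 1) with hC'
  set κ' := κ * Real.exp (- B 1) with hκ'
  have hC0 : 0 ≤ C' := ge_of_tendsto' hA fun N => (Real.exp_pos _).le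
  have hκ0 : 0 ≤ κ' := ge_of_tendsto' hEexp fun N => (Real.exp_pos _).le
  have up : κ' ≤ C' := by
    refine le_of_forall_gt_imp_ge_of_dense fun y hy => ?_
    obtain ⟨m, hm1, hm2⟩ := exists_between hy
    have hm0 : 0 < m := hC0.trans_lt hm1
    refine le_of_tendsto hEexp ?_
    have := abel_limit a E hElim (Real.log m) (Real.log y) (Real.log_lt_log hm0 hm2) (by
      filter_upwards [hA.eventually (gt_mem_nhds hm1)] with N hN
      exact (Real.le_log_iff_exp_le hm0).2 hN.le)
    filter_upwards [this] with s hs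
    exact (Real.le_log_iff_exp_le (hm0.trans hm2)).1 hs
  have low : C' ≤ κ' := by
    refine le_of_forall_lt_imp_le_of_dense fun y hy => ?_
    rcases le_or_gt y 0 with h0 | h0
    · exact h0.trans hκ0
    obtain ⟨m, hm1, hm2⟩ := exists_between hy
    have hm0 : 0 < m := h0.trans hm1
    refine ge_of_tendsto hEexp ?_
    have := abel_limit (fun n => - a n) (fun s => - E s) (fun s hs => by
        refine (hElim s hs).neg.congr fun N => ?_
        rw [← Finset.sum_neg_distrib]
        exact Finset.sum_congr rfl fun n _ => by ring) (- Real.log m) (- Real.log y)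
        (neg_lt_neg (Real.log_lt_log h0 hm1)) (by
      filter_upwards [hA.eventually (lt_mem_nhds hm2)] with N hN
      rw [Finset.sum_neg_distrib]
      exact neg_le_neg ((Real.log_le_iff_le_exp hm0).2 hN.le))
    filter_upwards [this] with s hs
    exact (Real.log_le_iff_le_exp h0).1 (neg_le_neg_iff.1 hs)
  have := le_antisymm up low
  exact mul_right_cancel₀ (Real.exp_pos _).ne' this

/-- For `S` a finite set of primes `≡ 1 mod 4`, `u ∈ {1, 5}`, and `C` the
value of the Euler-product limit `lim_{T→∞} ∏_{p ≤ T} (1 + f(p)/p)(1 − 1/p)`, one has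
`∑_{1 ≤ n ≤ Y, n ≡ u (mod 8)} f(n) = (1/2)·C·Y + o(Y)` as `Y → ∞`. -/
theorem stmt10 (S : Finset ℕ) (hS : ∀ p ∈ S, p.Prime ∧ p % 4 = 1)
    (u : ℕ) (hu : u = 1 ∨ u = 5) (C : ℝ)
    (hC : Tendsto (fun T : ℕ =>
        ∏ p ∈ (Finset.range (T + 1)).filter Nat.Prime,
          (1 + fSigma S p / p) * (1 - 1 / (p : ℝ)))
      atTop (nhds C)) :
    (fun Y : ℝ =>
        (∑ n ∈ (Finset.Icc 1 ⌊Y⌋₊).filter (fun n => n % 8 = u), fSigma S n) -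
          1 / 2 * C * Y)
      =o[atTop] fun Y : ℝ => Y := by

  have Icc_eq : ∀ N : ℕ, Finset.Icc 1 N = Finset.Ioc 0 N := by
    intro N; ext x; simp only [Finset.mem_Icc, Finset.mem_Ioc]; omega
  obtain ⟨κ, hκ⟩ := mean_theta S (chi4 * chi4) (1/2)
    (by
      intro n
      change |chi4 n * chi4 n| ≤ 1
      rw [chi4_apply]; split_ifs <;> norm_num)
    (by
      intro n
      change |chi4 n * chi4 n - 1/2| ≤ 1
      rw [chi4_apply]; split_ifs <;> norm_num [abs_le])
    (by
      intro n
      change chi4 (n+8) * chi4 (n+8) = chi4 n * chi4 n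
      rw [chi4_apply, chi4_apply, show (n + 8) % 2 = n % 2 by omega, show (n + 8) % 4 = n % 4 by omega])
    (by
      change ∑ i ∈ Finset.range 8, (chi4 i * chi4 i - 1/2) = 0
      simp only [Finset.sum_range_succ, Finset.sum_range_zero, chi4_apply]
      norm_num)
    (by
      change ∑ i ∈ Finset.range 8, (chi4 i * chi4 i * chi4 i) = 0
      simp only [Finset.sum_range_succ, Finset.sum_range_zero, chi4_apply]
      norm_num)
  obtain ⟨κ8, hκ8⟩ := mean_theta S chi8 0
    (by
      intro n
      rw [chi8_apply]; split_ifs <;> norm_num)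
    (by
      intro n
      rw [chi8_apply]; split_ifs <;> norm_num)
    (by
      intro n
      rw [chi8_apply, chi8_apply, show (n + 8) % 2 = n % 2 by omega, show (n + 8) % 8 = n % 8 by omega])
    (by
      simp only [Finset.sum_range_succ, Finset.sum_range_zero, chi8_apply]
      norm_num)
    (by
      simp only [Finset.sum_range_succ, Finset.sum_range_zero, chi4_apply, chi8_apply]
      norm_num)
  rw [zero_mul] at hκ8
  have hf4 : ∀ n, fSigma S n * (chi4 * chi4) n = fSigma S n := by
    intro n
    by_cases h : fSigma S n = 0
    · rw [h, zero_mul]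
    · have := fSigma_mod S n h
      change fSigma S n * (chi4 n * chi4 n) = _
      rw [chi4_apply, if_neg (by omega), if_pos this]; ring
  simp_rw [hf4] at hκ
  have hCκ : 1/2 * κ = C := by
    refine C_eq S C (1/2 * κ) ?_ ?_
    · refine hC.congr fun T => ?_
      rw [Nat.primesBelow]
      refine Finset.prod_congr rfl fun p _ => ?_
      rw [locF, Real.rpow_neg_one]
      ring
    · simp_rw [Icc_eq]; exact hκ
  rw [hCκ] at hκ
  have hterm : ∃ σ : ℝ, ∀ n, (if n % 8 = u then fSigma S n else 0) = 1/2 * fSigma S n + σ * (fSigma S n * chi8 n) := by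
    rcases hu with rfl | rfl
    · refine ⟨1/2, fun n => ?_⟩
      by_cases h : fSigma S n = 0
      · simp [h]
      · have := fSigma_mod S n h
        rw [chi8_apply, if_neg (show ¬ n % 2 = 0 by omega)]
        by_cases h1 : n % 8 = 1
        · simp [h1]; ring
        · have h5 : n % 8 = 5 := by omega
          simp [h5]
    · refine ⟨-(1/2), fun n => ?_⟩
      by_cases h : fSigma S n = 0
      · simp [h]
      · have := fSigma_mod S n h
        rw [chi8_apply, if_neg (show ¬ n % 2 = 0 by omega)]
        by_cases h1 : n % 8 = 1
        · simp [h1]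
        · have h5 : n % 8 = 5 := by omega
          simp [h5]; ring
  obtain ⟨σ, hσ⟩ := hterm
  have hN : Tendsto (fun N : ℕ => (∑ n ∈ (Finset.Icc 1 N).filter (fun n => n % 8 = u), fSigma S n) / (N:ℝ)) atTop (nhds (1/2 * C)) := by
    have := (hκ.const_mul (1/2)).add (hκ8.const_mul σ)
    rw [mul_zero, add_zero] at this
    refine this.congr fun N => ?_
    rw [Finset.sum_filter, Icc_eq, Finset.sum_congr rfl (fun n _ => hσ n), Finset.sum_add_distrib,
      ← Finset.mul_sum, ← Finset.mul_sum]
    ring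
  have hY := (hN.comp tendsto_nat_floor_atTop).mul (tendsto_nat_floor_div_atTop (R := ℝ))
  rw [mul_one] at hY
  rw [isLittleO_iff_tendsto' (by
    filter_upwards [eventually_gt_atTop 0] with Y hY h
    exact absurd h hY.ne')]
  have h2 := hY.sub_const (1/2 * C)
  rw [sub_self] at h2
  refine h2.congr' ?_
  filter_upwards [eventually_ge_atTop 1] with Y hY1
  have hYp : 0 < Y := by linarith
  have hfl : ((⌊Y⌋₊ : ℕ) : ℝ) ≠ 0 := by
    have := Nat.floor_pos.2 hY1
    positivity
  simp only [Function.comp]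
  field_simp
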